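/- Let λ be a partition with exactly 3 distinct part sizes, μ a rectangle, λ/μ a basic connected skew diagram, and suppose α/β is a basic connected skew diagram with β a rectangle such that s_{λ/μ} = s_{α/β}. Then α has exactly 3 distinct part sizes. -/

import Mathlib

open YoungDiagram
open scoped Classical

namespace LRSkew

/-- The cells of the skew diagram `lam/mu`. -/
def skewCells (lam mu : YoungDiagram) : Finset (ℕ × ℕ) := lam.cells \ mu.cells

/-- A semistandard filling of the skew shape `lam/mu`: entries are positive exactly on the
cells of the shape, rows are weakly increasing and columns are strictly increasing. -/
def IsSSYT (lam mu : YoungDiagram) (T : ℕ × ℕ → ℕ) : Prop :=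
  (∀ p, p ∈ skewCells lam mu ↔ T p ≠ 0) ∧
  (∀ i j1 j2, (i, j1) ∈ skewCells lam mu → (i, j2) ∈ skewCells lam mu → j1 ≤ j2 →
    T (i, j1) ≤ T (i, j2)) ∧
  (∀ i1 i2 j, (i1, j) ∈ skewCells lam mu → (i2, j) ∈ skewCells lam mu → i1 < i2 →
    T (i1, j) < T (i2, j))

/-- The number of entries equal to `k` among the cells read (in the reverse reading word:
right to left along rows, top row first) up to position `(i,j)`. -/
def prefixCount (lam mu : YoungDiagram) (T : ℕ × ℕ → ℕ) (i j k : ℕ) : ℕ :=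
  ((skewCells lam mu).filter fun p => (p.1 < i ∨ (p.1 = i ∧ j ≤ p.2)) ∧ T p = k).card

/-- The reverse reading word of the filling is a lattice word. -/
def IsLattice (lam mu : YoungDiagram) (T : ℕ × ℕ → ℕ) : Prop :=
  ∀ i j k, prefixCount lam mu T i j (k + 2) ≤ prefixCount lam mu T i j (k + 1)

/-- The number of entries of the filling equal to `k`. -/
def content (lam mu : YoungDiagram) (T : ℕ × ℕ → ℕ) (k : ℕ) : ℕ :=
  ((skewCells lam mu).filter fun p => T p = k).card

/-- A Littlewood–Richardson tableau of shape `lam/mu` and content `nu`. -/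
def IsLR (lam mu nu : YoungDiagram) (T : ℕ × ℕ → ℕ) : Prop :=
  IsSSYT lam mu T ∧ IsLattice lam mu T ∧ ∀ i, content lam mu T (i + 1) = nu.rowLen i

/-- The Littlewood–Richardson coefficient `c(lam; mu, nu)`. -/
noncomputable def lrCoeff (lam mu nu : YoungDiagram) : ℕ :=
  if mu ≤ lam then {T : ℕ × ℕ → ℕ | IsLR lam mu nu T}.ncard else 0

/-- Equality of the skew Schur functions `s_{lam/mu} = s_{alp/bet}`, expressed through
their expansions into Schur functions. -/
def SchurEq (lam mu alp bet : YoungDiagram) : Prop :=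
  ∀ nu : YoungDiagram, lrCoeff lam mu nu = lrCoeff alp bet nu

/-- The rectangular Young diagram `(k^l)` with `l` rows of length `k`. -/
def rect (k l : ℕ) : YoungDiagram :=
  ⟨Finset.range l ×ˢ Finset.range k, by
    intro a b hba ha
    simp only [Finset.coe_product, Set.mem_prod, Finset.mem_coe, Finset.mem_range] at ha ⊢
    exact ⟨lt_of_le_of_lt hba.1 ha.1, lt_of_le_of_lt hba.2 ha.2⟩⟩

/-- The complement of `nu` in the rectangle `(k^l)`, rotated by 180 degrees so that it is
again a partition: its parts are `(k - nu_l, …, k - nu_1)`. -/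
def complRect (k l : ℕ) (nu : YoungDiagram) : YoungDiagram :=
  ⟨(rect k l).cells.filter fun p => (l - 1 - p.1, k - 1 - p.2) ∉ nu, by
    intro a b hba ha
    simp only [Finset.coe_filter, Set.mem_setOf_eq, mem_cells] at ha ⊢
    refine ⟨(rect k l).isLowerSet hba ha.1, fun hmem => ha.2 ?_⟩
    exact nu.isLowerSet
      (Prod.mk_le_mk.mpr ⟨Nat.sub_le_sub_left hba.1 _, Nat.sub_le_sub_left hba.2 _⟩) hmem⟩

/-- The staircase partition `(n, n-1, …, 2, 1)`. -/
def staircase (n : ℕ) : YoungDiagram :=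
  ⟨(Finset.range n ×ˢ Finset.range n).filter fun p => p.1 + p.2 < n, by
    intro a b hba ha
    simp only [Finset.coe_filter, Set.mem_setOf_eq, Finset.mem_product, Finset.mem_range] at ha ⊢
    exact ⟨⟨lt_of_le_of_lt hba.1 ha.1.1, lt_of_le_of_lt hba.2 ha.1.2⟩,
      lt_of_le_of_lt (Nat.add_le_add hba.1 hba.2) ha.2⟩⟩

/-- A basic skew diagram: no empty rows and no empty columns. -/
def IsBasic (lam mu : YoungDiagram) : Prop :=
  (∀ i, i < lam.colLen 0 → mu.rowLen i < lam.rowLen i) ∧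
  (∀ j, j < lam.rowLen 0 → mu.colLen j < lam.colLen j)

/-- A (basic) skew diagram is connected iff consecutive rows share a column. -/
def IsConnectedSkew (lam mu : YoungDiagram) : Prop :=
  ∀ i, i + 1 < lam.colLen 0 → mu.rowLen i < lam.rowLen (i + 1)

/-- The number of distinct (positive) part sizes of a partition. -/
def dp (lam : YoungDiagram) : ℕ :=
  ((Finset.range (lam.colLen 0)).image fun i => lam.rowLen i).card

/-- A partition is a rectangle: all its parts are equal. -/
def IsRect (mu : YoungDiagram) : Prop :=
  ∀ i, i < mu.colLen 0 → mu.rowLen i = mu.rowLen 0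

/-- Cells of a skew diagram in the same connected component: the reflexive–transitive
closure of sharing a row or a column. -/
def SameComp (s : Finset (ℕ × ℕ)) : ℕ × ℕ → ℕ × ℕ → Prop :=
  Relation.ReflTransGen fun a b => a ∈ s ∧ b ∈ s ∧ (a.1 = b.1 ∨ a.2 = b.2)

/-- Two finite sets of boxes agree up to translation or 180°-rotation of each connected
component independently. -/
def UpToTransRot (s t : Finset (ℕ × ℕ)) : Prop :=
  ∃ f : ℕ × ℕ → ℕ × ℕ, Set.BijOn f ↑s ↑t ∧
    ∀ p ∈ s, ∀ q ∈ s, SameComp s p q →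
      (((f q).1 : ℤ) - (f p).1 = (q.1 : ℤ) - p.1 ∧ ((f q).2 : ℤ) - (f p).2 = (q.2 : ℤ) - p.2) ∨
      (((f q).1 : ℤ) - (f p).1 = (p.1 : ℤ) - q.1 ∧ ((f q).2 : ℤ) - (f p).2 = (p.2 : ℤ) - q.2)


theorem mem_skew {lam mu : YoungDiagram} {l k : ℕ}
    (hm : ∀ i j, (i, j) ∈ mu ↔ i < l ∧ j < k) (i j : ℕ) :
    (i, j) ∈ skewCells lam mu ↔ j < lam.rowLen i ∧ ¬ (i < l ∧ j < k) := by
  simp only [skewCells, Finset.mem_sdiff, mem_cells, hm, mem_iff_lt_rowLen]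

/-- The support of the Schur expansion, as functions. -/
def Cont (lam mu : YoungDiagram) (f : ℕ → ℕ) : Prop :=
  ∃ T, IsSSYT lam mu T ∧ IsLattice lam mu T ∧ ∀ i, content lam mu T (i + 1) = f i

theorem lattice_of_inj {lam mu : YoungDiagram} {T : ℕ × ℕ → ℕ} (φ : ℕ × ℕ → ℕ × ℕ)
    (h1 : ∀ p ∈ skewCells lam mu, 2 ≤ T p →
      φ p ∈ skewCells lam mu ∧ T (φ p) + 1 = T p ∧ (φ p).1 < p.1)
    (h2 : ∀ p ∈ skewCells lam mu, ∀ q ∈ skewCells lam mu, 2 ≤ T p → T p = T q →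
      φ p = φ q → p = q) : IsLattice lam mu T := by
  intro i j k
  unfold prefixCount
  apply Finset.card_le_card_of_injOn φ
  · intro p hp
    simp only [Finset.coe_filter, Set.mem_ofPred_eq] at hp ⊢
    obtain ⟨hp, hq, hT⟩ := hp
    obtain ⟨a, b, c⟩ := h1 p hp (by omega)
    refine ⟨a, ?_, by omega⟩
    left; omega
  · intro p hp q hq hpq
    simp only [Finset.coe_filter, Set.mem_ofPred_eq] at hp hq
    exact h2 p hp.1 q hq.1 (by omega) (by omega) hpq

theorem lattice_exists {lam mu : YoungDiagram} {T : ℕ × ℕ → ℕ}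
    (hS : IsSSYT lam mu T) (hL : IsLattice lam mu T) {i j v : ℕ}
    (hp : (i, j) ∈ skewCells lam mu) (hv : T (i, j) = v + 2) :
    ∃ i' j', (i', j') ∈ skewCells lam mu ∧ i' < i ∧ T (i', j') = v + 1 := by
  have h := hL i j v
  unfold prefixCount at h
  have h1 : 0 < ((skewCells lam mu).filter fun p =>
      (p.1 < i ∨ (p.1 = i ∧ j ≤ p.2)) ∧ T p = v + 2).card := by
    apply Finset.card_pos.2
    exact ⟨(i, j), by simp [hp, hv]⟩
  have h2 := lt_of_lt_of_le h1 h
  obtain ⟨⟨i', j'⟩, hq⟩ := Finset.card_pos.1 h2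
  simp only [Finset.mem_filter] at hq
  obtain ⟨hq, hc, hT⟩ := hq
  refine ⟨i', j', hq, ?_, hT⟩
  rcases hc with hc | ⟨rfl, hc⟩
  · exact hc
  · have := hS.2.1 i' j j' hp hq hc
    omega

theorem T_le {lam mu : YoungDiagram} {T : ℕ × ℕ → ℕ}
    (hS : IsSSYT lam mu T) (hL : IsLattice lam mu T) :
    ∀ i j, (i, j) ∈ skewCells lam mu → T (i, j) ≤ i + 1 := by
  intro i
  induction i using Nat.strong_induction_on with
  | _ i ih =>
    intro j hp
    by_contra hcon
    obtain ⟨v, hv⟩ : ∃ v, T (i, j) = v + 2 := ⟨T (i, j) - 2, by omega⟩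
    obtain ⟨i', j', hq, hi, hT⟩ := lattice_exists hS hL hp hv
    have := ih i' hi j' hq
    omega

theorem T_pos {lam mu : YoungDiagram} {T : ℕ × ℕ → ℕ}
    (hS : IsSSYT lam mu T) {p} (hp : p ∈ skewCells lam mu) : 1 ≤ T p :=
  Nat.one_le_iff_ne_zero.2 ((hS.1 p).1 hp)

/-- The minimal filling. -/
def minFill (lam mu : YoungDiagram) (l k : ℕ) (p : ℕ × ℕ) : ℕ :=
  if p ∈ skewCells lam mu then (if p.2 < k then p.1 - l + 1 else p.1 + 1) else 0

theorem T_ge {lam mu : YoungDiagram} {T : ℕ × ℕ → ℕ} {l k : ℕ}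
    (hm : ∀ i j, (i, j) ∈ mu ↔ i < l ∧ j < k)
    (hS : IsSSYT lam mu T) :
    ∀ i j, (i, j) ∈ skewCells lam mu → minFill lam mu l k (i, j) ≤ T (i, j) := by
  intro i
  induction i with
  | zero =>
    intro j hp
    have := T_pos hS hp
    simp only [minFill, hp, if_true]
    split_ifs <;> omega
  | succ i ih =>
    intro j hp
    have h1 := T_pos hS hp
    by_cases hq : (i, j) ∈ skewCells lam mu
    · have h2 := ih j hq
      have h3 := hS.2.2 i (i + 1) j hq hp (by omega)
      simp only [minFill, hp, hq, if_true] at h2 ⊢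
      split_ifs at h2 ⊢ <;> omega
    · simp only [minFill, hp, if_true]
      rw [mem_skew hm] at hp hq
      have := lam.rowLen_anti i (i + 1) (by omega)
      have h5 : i < l ∧ j < k := by
        by_contra h; exact hq ⟨by omega, h⟩
      simp only [h5.2, if_true]
      omega

theorem T_eq_right {lam mu : YoungDiagram} {T : ℕ × ℕ → ℕ} {l k : ℕ}
    (hm : ∀ i j, (i, j) ∈ mu ↔ i < l ∧ j < k)
    (hS : IsSSYT lam mu T) (hL : IsLattice lam mu T) {i j : ℕ}
    (hp : (i, j) ∈ skewCells lam mu) (hj : k ≤ j) : T (i, j) = i + 1 := by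
  have h1 := T_ge hm hS i j hp
  have h2 := T_le hS hL i j hp
  simp only [minFill, hp, if_true, not_lt.2 hj, if_false] at h1
  omega

/-- the sum of values is determined by the contents. -/
theorem map_eq_of_content {lam mu : YoungDiagram} {T U : ℕ × ℕ → ℕ}
    (hT : ∀ p ∈ skewCells lam mu, 1 ≤ T p) (hU : ∀ p ∈ skewCells lam mu, 1 ≤ U p)
    (h : ∀ i, content lam mu T (i + 1) = content lam mu U (i + 1)) :
    (skewCells lam mu).val.map T = (skewCells lam mu).val.map U := by
  ext v
  rw [Multiset.count_map, Multiset.count_map]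
  rcases v with _ | v
  · rw [Multiset.filter_eq_nil.2, Multiset.filter_eq_nil.2]
    · intro p hp; have := hU p hp; omega
    · intro p hp; have := hT p hp; omega
  · have := h v
    unfold content at this
    simp only [Finset.card_def, Finset.filter_val] at this
    simpa [eq_comm] using this

theorem ncells_le {lam mu : YoungDiagram} {T : ℕ × ℕ → ℕ}
    (hT : ∀ p ∈ skewCells lam mu, 1 ≤ T p) (m : ℕ) :
    ∑ i ∈ Finset.range m, content lam mu T (i + 1) =
      ((skewCells lam mu).filter fun p => T p ≤ m).card := by
  induction m with
  | zero =>
    rw [Finset.sum_range_zero, eq_comm, Finset.card_eq_zero, Finset.filter_eq_empty_iff]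
    intro p hp; have := hT p hp; omega
  | succ m ih =>
    rw [Finset.sum_range_succ, ih, content, ← Finset.card_union_of_disjoint]
    · congr 1
      ext p
      simp only [Finset.mem_union, Finset.mem_filter]
      constructor
      · rintro (h | h) <;> exact ⟨h.1, by omega⟩
      · rintro ⟨h1, h2⟩
        by_cases h : T p ≤ m
        · exact Or.inl ⟨h1, h⟩
        · exact Or.inr ⟨h1, by omega⟩
    · rw [Finset.disjoint_filter]
      intro p _ h1 h2; omega

/-- The modified minimal filling. -/
def modFill (lam mu : YoungDiagram) (l k c r s : ℕ) (p : ℕ × ℕ) : ℕ :=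
  if p ∈ skewCells lam mu then
    (if p.2 < k then p.1 - l + 1 + (if p.2 = c ∧ l + r ≤ p.1 then s - r else 0) else p.1 + 1)
  else 0

theorem minFill_ssyt {lam mu : YoungDiagram} {l k : ℕ}
    (hm : ∀ i j, (i, j) ∈ mu ↔ i < l ∧ j < k) :
    IsSSYT lam mu (minFill lam mu l k) := by
  refine ⟨?_, ?_, ?_⟩
  · intro p
    unfold minFill
    split_ifs <;> simp_all
  · intro i j1 j2 h1 h2 hj
    simp only [minFill, h1, h2, if_true]
    split_ifs <;> omega
  · intro i1 i2 j h1 h2 hi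
    simp only [minFill, h1, h2, if_true]
    rw [mem_skew hm] at h1 h2
    split_ifs <;> omega

theorem minFill_lattice {lam mu : YoungDiagram} {l k : ℕ}
    (hm : ∀ i j, (i, j) ∈ mu ↔ i < l ∧ j < k) :
    IsLattice lam mu (minFill lam mu l k) := by
  apply lattice_of_inj (fun p => (p.1 - 1, p.2))
  · rintro ⟨i, j⟩ hp h2
    have hq : (i - 1, j) ∈ skewCells lam mu := by
      simp only [minFill, hp, if_true] at h2
      rw [mem_skew hm] at hp ⊢
      have := lam.rowLen_anti (i - 1) i (by omega)
      refine ⟨by omega, ?_⟩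
      split_ifs at h2 <;> omega
    refine ⟨hq, ?_, ?_⟩ <;> simp only [minFill, hp, hq, if_true] at h2 ⊢ <;>
      split_ifs at h2 ⊢ <;> omega
  · rintro ⟨i, j⟩ hp ⟨i', j'⟩ hq h2 h3 h4
    simp only [minFill, hp, hq, if_true] at h2 h3
    simp only [Prod.mk.injEq] at h4
    obtain ⟨h4, rfl⟩ := h4
    rw [Prod.mk.injEq]
    refine ⟨?_, rfl⟩
    rw [mem_skew hm] at hp hq
    split_ifs at h2 h3 <;> omega

theorem modFill_ssyt {lam mu : YoungDiagram} {l k c r s : ℕ}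
    (hm : ∀ i j, (i, j) ∈ mu ↔ i < l ∧ j < k)
    (hc : c + 1 = k ∨ lam.rowLen (l + r) ≤ c + 1) (hs : s ≤ l + r) :
    IsSSYT lam mu (modFill lam mu l k c r s) := by
  refine ⟨?_, ?_, ?_⟩
  · intro p
    unfold modFill
    split_ifs <;> simp_all
  · intro i j1 j2 h1 h2 hj
    simp only [modFill, h1, h2, if_true]
    rw [mem_skew hm] at h1 h2
    by_cases h : l + r ≤ i
    · have := lam.rowLen_anti (l + r) i h
      split_ifs <;> omega
    · split_ifs <;> omega
  · intro i1 i2 j h1 h2 hi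
    simp only [modFill, h1, h2, if_true]
    rw [mem_skew hm] at h1 h2
    split_ifs <;> omega

theorem modFill_lattice {lam mu : YoungDiagram} {l k c r s : ℕ}
    (hm : ∀ i j, (i, j) ∈ mu ↔ i < l ∧ j < k)
    (hs : s + 1 ≤ l + r) (hr : r ≤ s) (hk : k < lam.rowLen s)
    (hd : lam.rowLen (s + 1) < lam.rowLen s) :
    IsLattice lam mu (modFill lam mu l k c r (s + 1)) := by
  apply lattice_of_inj (fun p => if p.2 = c ∧ c < k ∧ p.1 = l + r then (s, lam.rowLen s - 1)
    else (p.1 - 1, p.2))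
  · rintro ⟨i, j⟩ hp h2
    by_cases hcase : j = c ∧ c < k ∧ i = l + r
    · have hq : (s, lam.rowLen s - 1) ∈ skewCells lam mu := by
        rw [mem_skew hm]; omega
      obtain ⟨rfl, h, rfl⟩ := hcase
      simp only [h, and_self, if_true]
      refine ⟨hq, ?_, ?_⟩
      · simp only [modFill, hq, hp, if_true, h, le_refl, and_self]
        have e : l + r - l = r := by omega
        rw [e, if_neg (by omega)]
        omega
      · omega
    · simp only [hcase, if_false]
      have hq : (i - 1, j) ∈ skewCells lam mu := by
        simp only [modFill, hp, if_true] at h2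
        rw [mem_skew hm] at hp ⊢
        have := lam.rowLen_anti (i - 1) i (by omega)
        refine ⟨by omega, ?_⟩
        split_ifs at h2 <;> omega
      have hq' := hq
      rw [mem_skew hm] at hq'
      refine ⟨hq, ?_, ?_⟩ <;> simp only [modFill, hp, hq, if_true] at h2 ⊢ <;>
        split_ifs at h2 ⊢ <;> omega
  · rintro ⟨i, j⟩ hp ⟨i', j'⟩ hq h2 h3 h4
    simp only [modFill, hp, hq, if_true] at h2 h3
    rw [mem_skew hm] at hp hq
    simp only at h4
    have key : ∀ i j, j < lam.rowLen i → ¬ (i < l ∧ j < k) → (i - 1 = s ∧ j = lam.rowLen s - 1) →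
        2 ≤ i ∨ 1 ≤ i → False := by
      intro i j a b c d
      obtain ⟨c1, c2⟩ := c
      have : i = s + 1 := by omega
      subst this
      omega
    rw [Prod.mk.injEq]
    split_ifs at h4 with h5 h6 h6
    · omega
    · rw [Prod.mk.injEq] at h4
      exfalso
      apply key i' j' hq.1 hq.2 (by omega)
      split_ifs at h3 <;> omega
    · rw [Prod.mk.injEq] at h4
      exfalso
      apply key i j hp.1 hp.2 (by omega)
      split_ifs at h2 <;> omega
    · rw [Prod.mk.injEq] at h4
      obtain ⟨h4, rfl⟩ := h4
      refine ⟨?_, rfl⟩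
      split_ifs at h2 h3 <;> omega

/-- The content of the minimal filling. -/
def nuS (lam : YoungDiagram) (l k v : ℕ) : ℕ :=
  (lam.rowLen v - k) + min (lam.rowLen (l + v)) k

theorem minFill_content {lam mu : YoungDiagram} {l k : ℕ}
    (hm : ∀ i j, (i, j) ∈ mu ↔ i < l ∧ j < k) (v : ℕ) :
    content lam mu (minFill lam mu l k) (v + 1) = nuS lam l k v := by
  unfold content nuS
  have : ((skewCells lam mu).filter fun p => minFill lam mu l k p = v + 1) =
      (Finset.Ico k (lam.rowLen v)).image (fun j => (v, j)) ∪
      (Finset.range (min (lam.rowLen (l + v)) k)).image (fun j => (l + v, j)) := by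
    ext ⟨i, j⟩
    simp only [Finset.mem_filter, Finset.mem_union, Finset.mem_image, Finset.mem_Ico,
      Finset.mem_range, Prod.mk.injEq]
    constructor
    · rintro ⟨hp, h⟩
      simp only [minFill, hp, if_true] at h
      rw [mem_skew hm] at hp
      split_ifs at h with hj
      · right
        have : l + v = i := by omega
        subst this
        exact ⟨j, by omega, rfl, rfl⟩
      · left
        have : i = v := by omega
        subst this
        exact ⟨j, by omega, rfl, rfl⟩
    · rintro (⟨j', h, rfl, rfl⟩ | ⟨j', h, rfl, rfl⟩)
      · have hp : (v, j') ∈ skewCells lam mu := by rw [mem_skew hm]; omega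
        refine ⟨hp, ?_⟩
        simp only [minFill, hp, if_true]
        rw [if_neg (by omega)]
      · have hp : (l + v, j') ∈ skewCells lam mu := by rw [mem_skew hm]; omega
        refine ⟨hp, ?_⟩
        simp only [minFill, hp, if_true]
        rw [if_pos (by omega)]
        omega
  rw [this, Finset.card_union_of_disjoint, Finset.card_image_of_injective,
    Finset.card_image_of_injective, Nat.card_Ico, Finset.card_range]
  · intro a b h; simpa using h
  · intro a b h; simpa using h
  · rw [Finset.disjoint_left]
    rintro ⟨i, j⟩ h1 h2
    simp only [Finset.mem_image, Finset.mem_Ico,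
      Finset.mem_range, Prod.mk.injEq] at h1 h2
    obtain ⟨a, ha, rfl, rfl⟩ := h1
    obtain ⟨b, hb, _, rfl⟩ := h2
    omega

theorem nuS_cont {lam mu : YoungDiagram} {l k : ℕ}
    (hm : ∀ i j, (i, j) ∈ mu ↔ i < l ∧ j < k) : Cont lam mu (nuS lam l k) :=
  ⟨_, minFill_ssyt hm, minFill_lattice hm, minFill_content hm⟩

theorem cont_dom {lam mu : YoungDiagram} {l k : ℕ}
    (hm : ∀ i j, (i, j) ∈ mu ↔ i < l ∧ j < k) {f : ℕ → ℕ} (hf : Cont lam mu f) (m : ℕ) :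
    ∑ i ∈ Finset.range m, f i ≤ ∑ i ∈ Finset.range m, nuS lam l k i := by
  obtain ⟨T, hS, hL, hc⟩ := hf
  have e1 : ∑ i ∈ Finset.range m, f i = ∑ i ∈ Finset.range m, content lam mu T (i + 1) :=
    Finset.sum_congr rfl fun i _ => (hc i).symm
  have e2 : ∑ i ∈ Finset.range m, nuS lam l k i =
      ∑ i ∈ Finset.range m, content lam mu (minFill lam mu l k) (i + 1) :=
    Finset.sum_congr rfl fun i _ => (minFill_content hm i).symm
  rw [e1, e2, ncells_le (fun p hp => T_pos hS hp),
    ncells_le (fun p hp => T_pos (minFill_ssyt hm) hp)]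
  apply Finset.card_le_card
  rintro ⟨i, j⟩ hp
  simp only [Finset.mem_filter] at hp ⊢
  exact ⟨hp.1, le_trans (T_ge hm hS i j hp.1) hp.2⟩

theorem nuS_inv {lam mu alp bet : YoungDiagram} {l k q p : ℕ}
    (hm : ∀ i j, (i, j) ∈ mu ↔ i < l ∧ j < k)
    (hb : ∀ i j, (i, j) ∈ bet ↔ i < q ∧ j < p)
    (h : ∀ f, Cont lam mu f ↔ Cont alp bet f) (i : ℕ) :
    nuS lam l k i = nuS alp q p i := by
  have H : ∀ m, ∑ i ∈ Finset.range m, nuS lam l k i = ∑ i ∈ Finset.range m, nuS alp q p i :=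
    fun m => le_antisymm (cont_dom hb ((h _).1 (nuS_cont hm)) m)
      (cont_dom hm ((h _).2 (nuS_cont hb)) m)
  have h1 := H i
  have h2 := H (i + 1)
  rw [Finset.sum_range_succ, Finset.sum_range_succ] at h2
  omega

theorem row_lt {lam mu : YoungDiagram} {i j : ℕ} (hp : (i, j) ∈ skewCells lam mu) :
    i < lam.colLen 0 := by
  rw [← mem_iff_lt_colLen]
  simp only [skewCells, Finset.mem_sdiff, mem_cells] at hp
  exact lam.isLowerSet (Prod.mk_le_mk.mpr ⟨le_refl i, Nat.zero_le j⟩) hp.1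

theorem cont_zero {lam mu : YoungDiagram} {f : ℕ → ℕ} (hf : Cont lam mu f) {i : ℕ}
    (hi : lam.colLen 0 ≤ i) : f i = 0 := by
  obtain ⟨T, hS, hL, hc⟩ := hf
  rw [← hc, content, Finset.card_eq_zero, Finset.filter_eq_empty_iff]
  rintro ⟨a, b⟩ hp h
  have := T_le hS hL a b hp
  have := row_lt hp
  omega

theorem prefix_content {lam mu : YoungDiagram} (T : ℕ × ℕ → ℕ) (v : ℕ) :
    prefixCount lam mu T (lam.colLen 0) 0 v = content lam mu T v := by
  unfold prefixCount content
  congr 1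
  ext ⟨a, b⟩
  simp only [Finset.mem_filter]
  constructor
  · rintro ⟨h1, _, h2⟩; exact ⟨h1, h2⟩
  · rintro ⟨h1, h2⟩; exact ⟨h1, Or.inl (row_lt h1), h2⟩

theorem cont_anti {lam mu : YoungDiagram} {f : ℕ → ℕ} (hf : Cont lam mu f) : Antitone f := by
  obtain ⟨T, hS, hL, hc⟩ := hf
  apply antitone_nat_of_succ_le
  intro n
  rw [← hc, ← hc, ← prefix_content, ← prefix_content]
  exact hL _ _ _

theorem exists_young {f : ℕ → ℕ} (ha : Antitone f) {N : ℕ} (hN : ∀ i, N ≤ i → f i = 0) :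
    ∃ nu : YoungDiagram, ∀ i, nu.rowLen i = f i := by
  let nu : YoungDiagram :=
    ⟨(Finset.range N ×ˢ Finset.range (f 0)).filter fun p => p.2 < f p.1, by
      rintro ⟨a, b⟩ ⟨c, d⟩ hba h
      obtain ⟨h1, h2⟩ := Prod.mk_le_mk.1 hba
      simp only [Finset.coe_filter, Set.mem_ofPred_eq, Finset.mem_product, Finset.mem_range] at h ⊢
      have := ha h1
      omega⟩
  refine ⟨nu, fun i => ?_⟩
  have key : ∀ j, j < nu.rowLen i ↔ j < f i := by
    intro j
    rw [← mem_iff_lt_rowLen, ← mem_cells]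
    show (i, j) ∈ (Finset.range N ×ˢ Finset.range (f 0)).filter (fun p => p.2 < f p.1) ↔ _
    simp only [Finset.mem_filter, Finset.mem_product, Finset.mem_range]
    constructor
    · exact fun h => h.2
    · intro h
      refine ⟨⟨?_, ?_⟩, h⟩
      · by_contra h'
        have := hN i (by omega)
        omega
      · have := ha (Nat.zero_le i)
        omega
  have h1 := key (f i)
  have h2 := key (nu.rowLen i)
  omega

theorem finite_LR (lam mu nu : YoungDiagram) : {T : ℕ × ℕ → ℕ | IsLR lam mu nu T}.Finite := by
  let M := lam.colLen 0 + 1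
  let F : ((skewCells lam mu) → Fin M) → (ℕ × ℕ → ℕ) :=
    fun g p => if h : p ∈ skewCells lam mu then (g ⟨p, h⟩ : ℕ) else 0
  apply (Set.finite_range F).subset
  rintro T ⟨hS, hL, -⟩
  refine ⟨fun p => ⟨T p.1, ?_⟩, ?_⟩
  · obtain ⟨⟨i, j⟩, hp⟩ := p
    have := T_le hS hL i j hp
    have := row_lt hp
    show T (i, j) < lam.colLen 0 + 1
    omega
  · funext p
    simp only [F]
    split_ifs with h
    · rfl
    · by_contra h'
      exact h ((hS.1 p).2 (Ne.symm h'))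

theorem cont_of_schur {lam mu alp bet : YoungDiagram} (h1 : mu ≤ lam) (h2 : bet ≤ alp)
    (h : SchurEq lam mu alp bet) {f : ℕ → ℕ} (hf : Cont lam mu f) : Cont alp bet f := by
  obtain ⟨nu, hnu⟩ := exists_young (cont_anti hf) (fun i hi => cont_zero hf hi)
  obtain ⟨T, hS, hL, hc⟩ := hf
  have h3 := h nu
  rw [lrCoeff, lrCoeff, if_pos h1, if_pos h2] at h3
  have h4 : 0 < {T : ℕ × ℕ → ℕ | IsLR lam mu nu T}.ncard := by
    rw [Set.ncard_pos (finite_LR _ _ _)]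
    exact ⟨T, hS, hL, fun i => by rw [hc, hnu]⟩
  rw [h3] at h4
  obtain ⟨U, hU1, hU2, hU3⟩ := Set.nonempty_of_ncard_ne_zero h4.ne'
  exact ⟨U, hU1, hU2, fun i => by rw [hU3, hnu]⟩

theorem cont_iff {lam mu alp bet : YoungDiagram} (h1 : mu ≤ lam) (h2 : bet ≤ alp)
    (h : SchurEq lam mu alp bet) (f : ℕ → ℕ) : Cont lam mu f ↔ Cont alp bet f :=
  ⟨cont_of_schur h1 h2 h, cont_of_schur h2 h1 (fun nu => (h nu).symm)⟩

theorem prefix_content' {lam mu : YoungDiagram} (T : ℕ × ℕ → ℕ) (v : ℕ) {M : ℕ}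
    (hM : lam.colLen 0 ≤ M) :
    prefixCount lam mu T M 0 v = content lam mu T v := by
  unfold prefixCount content
  congr 1
  ext ⟨a, b⟩
  simp only [Finset.mem_filter]
  constructor
  · rintro ⟨h1, _, h2⟩; exact ⟨h1, h2⟩
  · rintro ⟨h1, h2⟩; exact ⟨h1, Or.inl (lt_of_lt_of_le (row_lt h1) hM), h2⟩

theorem rowLen_pos_iff (lam : YoungDiagram) (i : ℕ) : 0 < lam.rowLen i ↔ i < lam.colLen 0 := by
  rw [← mem_iff_lt_colLen, ← mem_iff_lt_rowLen]

theorem prefix_trim {lam lam1 mu : YoungDiagram} {l k : ℕ}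
    (hm : ∀ i j, (i, j) ∈ mu ↔ i < l ∧ j < k)
    (h1 : ∀ i, lam1.rowLen i = lam.rowLen i - 1)
    (hrow : ∀ i, i < l → k < lam.rowLen i)
    {T U : ℕ × ℕ → ℕ} (hTU : ∀ p ∈ skewCells lam1 mu, U p = T p)
    (hend : ∀ i, i < lam.colLen 0 → T (i, lam.rowLen i - 1) = i + 1) (i j v : ℕ) :
    prefixCount lam mu T i j (v + 1) = prefixCount lam1 mu U i j (v + 1) +
      (if v < lam.colLen 0 ∧ (v < i ∨ (v = i ∧ j ≤ lam.rowLen v - 1)) then 1 else 0) := by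
  unfold prefixCount
  have key : ((skewCells lam mu).filter fun p =>
      (p.1 < i ∨ (p.1 = i ∧ j ≤ p.2)) ∧ T p = v + 1) =
    ((skewCells lam1 mu).filter fun p =>
      (p.1 < i ∨ (p.1 = i ∧ j ≤ p.2)) ∧ U p = v + 1) ∪
      (if v < lam.colLen 0 ∧ (v < i ∨ (v = i ∧ j ≤ lam.rowLen v - 1)) then
        {(v, lam.rowLen v - 1)} else ∅) := by
    ext ⟨a, b⟩
    simp only [Finset.mem_union, Finset.mem_filter]
    constructor
    · rintro ⟨hp, hpre, hT⟩
      by_cases hq : (a, b) ∈ skewCells lam1 mu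
      · left; exact ⟨hq, hpre, by rw [hTU _ hq, hT]⟩
      · right
        have hN := row_lt hp
        rw [mem_skew hm] at hp hq
        have := h1 a
        have hb : b = lam.rowLen a - 1 := by
          by_contra hne; apply hq; exact ⟨by omega, hp.2⟩
        subst hb
        have := hend a hN
        have hav : a = v := by omega
        subst hav
        rw [if_pos ⟨hN, hpre⟩]
        exact Finset.mem_singleton_self _
    · rintro (⟨hp, hpre, hT⟩ | h)
      · refine ⟨?_, hpre, by rw [← hTU _ hp, hT]⟩
        rw [mem_skew hm] at hp ⊢
        have := h1 a
        exact ⟨by omega, hp.2⟩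
      · split_ifs at h with hc
        · rw [Finset.mem_singleton, Prod.mk.injEq] at h
          obtain ⟨rfl, rfl⟩ := h
          refine ⟨?_, hc.2, hend _ hc.1⟩
          have := (rowLen_pos_iff lam a).2 hc.1
          rw [mem_skew hm]
          refine ⟨by omega, fun h => ?_⟩
          have := hrow a h.1
          omega
        · simp at h
  rw [key, Finset.card_union_of_disjoint]
  · split_ifs <;> simp
  · rw [Finset.disjoint_right]
    rintro ⟨a, b⟩ h hp
    split_ifs at h with hc
    · rw [Finset.mem_singleton, Prod.mk.injEq] at h
      obtain ⟨rfl, rfl⟩ := h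
      have hp := (Finset.mem_filter.1 hp).1
      rw [mem_skew hm] at hp
      have := h1 a
      omega
    · simp at h

theorem colLen_trim {lam lam1 : YoungDiagram}
    (h1 : ∀ i, lam1.rowLen i = lam.rowLen i - 1) : lam1.colLen 0 ≤ lam.colLen 0 := by
  by_contra h
  have h2 := (rowLen_pos_iff lam1 (lam.colLen 0)).2 (by omega)
  have h3 := (rowLen_pos_iff lam (lam.colLen 0)).1 (by have := h1 (lam.colLen 0); omega)
  omega

theorem trim_cont {lam lam1 mu : YoungDiagram} {l k : ℕ}
    (hm : ∀ i j, (i, j) ∈ mu ↔ i < l ∧ j < k)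
    (h1 : ∀ i, lam1.rowLen i = lam.rowLen i - 1)
    (hrow : ∀ i, i < l → k < lam.rowLen i) (g : ℕ → ℕ) :
    Cont lam1 mu g ↔ Cont lam mu (fun i => g i + if i < lam.colLen 0 then 1 else 0) := by
  have hsub : ∀ a b, (a, b) ∈ skewCells lam1 mu → (a, b) ∈ skewCells lam mu := by
    intro a b hp
    rw [mem_skew hm] at hp ⊢
    have := h1 a
    exact ⟨by omega, hp.2⟩
  have hendm : ∀ a, a < lam.colLen 0 → (a, lam.rowLen a - 1) ∈ skewCells lam mu := by
    intro a ha
    have := (rowLen_pos_iff lam a).2 ha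
    rw [mem_skew hm]
    refine ⟨by omega, fun h => ?_⟩
    have := hrow a h.1
    omega
  have hsplit : ∀ a b, (a, b) ∈ skewCells lam mu → (a, b) ∉ skewCells lam1 mu →
      b = lam.rowLen a - 1 := by
    intro a b hp hq
    rw [mem_skew hm] at hp hq
    have := h1 a
    by_contra hne; apply hq; exact ⟨by omega, hp.2⟩
  have hcontent : ∀ T U : ℕ × ℕ → ℕ, (∀ p ∈ skewCells lam1 mu, U p = T p) →
      (∀ i, i < lam.colLen 0 → T (i, lam.rowLen i - 1) = i + 1) → ∀ v,
      content lam mu T (v + 1) = content lam1 mu U (v + 1) +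
        if v < lam.colLen 0 then 1 else 0 := by
    intro T U hTU hend v
    rw [← prefix_content' T (v + 1) (le_refl _), ← prefix_content' U (v + 1) (colLen_trim h1),
      prefix_trim hm h1 hrow hTU hend]
    congr 1
    split_ifs <;> omega
  constructor
  · rintro ⟨U, hS, hL, hc⟩
    let T : ℕ × ℕ → ℕ := fun p => if p ∈ skewCells lam1 mu then U p else
      if p ∈ skewCells lam mu then p.1 + 1 else 0
    have hT1 : ∀ p, p ∈ skewCells lam1 mu → T p = U p := fun p hp => if_pos hp
    have hT2 : ∀ p, p ∉ skewCells lam1 mu → p ∈ skewCells lam mu → T p = p.1 + 1 :=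
      fun p hp hq => by simp only [T]; rw [if_neg hp, if_pos hq]
    have hTU : ∀ p ∈ skewCells lam1 mu, U p = T p := fun p hp => (hT1 p hp).symm
    have hend : ∀ i, i < lam.colLen 0 → T (i, lam.rowLen i - 1) = i + 1 := by
      intro i hi
      apply hT2 _ _ (hendm i hi)
      rw [mem_skew hm]
      have := h1 i
      omega
    refine ⟨T, ⟨?_, ?_, ?_⟩, ?_, ?_⟩
    · rintro ⟨a, b⟩
      by_cases hp : (a, b) ∈ skewCells lam1 mu
      · rw [hT1 _ hp]
        exact ⟨fun _ => (hS.1 _).1 hp, fun _ => hsub a b hp⟩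
      · by_cases hq : (a, b) ∈ skewCells lam mu
        · rw [hT2 _ hp hq]; simp [hq]
        · simp only [T]; simp [hp, hq]
    · intro a b1 b2 hp hq hb
      by_cases hq1 : (a, b2) ∈ skewCells lam1 mu
      · have hp1 : (a, b1) ∈ skewCells lam1 mu := by
          rw [mem_skew hm] at hp hq1 ⊢
          exact ⟨by omega, hp.2⟩
        rw [hT1 _ hp1, hT1 _ hq1]
        exact hS.2.1 a b1 b2 hp1 hq1 hb
      · rw [hT2 _ hq1 hq]
        by_cases hp1 : (a, b1) ∈ skewCells lam1 mu
        · rw [hT1 _ hp1]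
          exact T_le hS hL a b1 hp1
        · rw [hT2 _ hp1 hp]
    · intro a1 a2 b hp hq ha
      by_cases hp1 : (a1, b) ∈ skewCells lam1 mu
      · by_cases hq1 : (a2, b) ∈ skewCells lam1 mu
        · rw [hT1 _ hp1, hT1 _ hq1]
          exact hS.2.2 a1 a2 b hp1 hq1 ha
        · rw [hT1 _ hp1, hT2 _ hq1 hq]
          have := T_le hS hL a1 b hp1
          show _ < a2 + 1
          omega
      · have hq1 : (a2, b) ∉ skewCells lam1 mu := by
          have h3 := hsplit a1 b hp hp1
          rw [mem_skew hm] at hp hp1 ⊢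
          have := h1 a2
          have := lam.rowLen_anti a1 a2 ha.le
          omega
        rw [hT2 _ hp1 hp, hT2 _ hq1 hq]
        show a1 + 1 < a2 + 1
        omega
    · intro i j v
      rw [prefix_trim hm h1 hrow hTU hend, prefix_trim hm h1 hrow hTU hend]
      have h3 : prefixCount lam1 mu U i j (v + 1 + 1) ≤ prefixCount lam1 mu U i j (v + 1) := hL i j v
      split_ifs <;> omega
    · intro i
      rw [hcontent T U hTU hend, hc]
  · rintro ⟨T, hS, hL, hc⟩
    have hend : ∀ i, i < lam.colLen 0 → T (i, lam.rowLen i - 1) = i + 1 := by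
      have hex : ∀ d i, i + d + 1 = lam.colLen 0 →
          ∃ j, (i, j) ∈ skewCells lam mu ∧ T (i, j) = i + 1 := by
        intro d
        induction d with
        | zero =>
          intro i hi
          have h3 := hc i
          beta_reduce at h3
          rw [if_pos (by omega)] at h3
          have h4 : 0 < content lam mu T (i + 1) := by omega
          obtain ⟨⟨a, b⟩, hq⟩ := Finset.card_pos.1 h4
          simp only [Finset.mem_filter] at hq
          have := row_lt hq.1
          have := T_le hS hL a b hq.1
          have : a = i := by omega
          subst this
          exact ⟨b, hq⟩
        | succ d ih =>
          intro i hi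
          obtain ⟨j, hp, hv⟩ := ih (i + 1) (by omega)
          obtain ⟨a, b, hq, ha, hT⟩ := lattice_exists hS hL hp hv
          have := T_le hS hL a b hq
          have : a = i := by omega
          subst this
          exact ⟨b, hq, hT⟩
      intro i hi
      obtain ⟨j, hp, hT⟩ := hex (lam.colLen 0 - i - 1) i (by omega)
      have h3 := hendm i hi
      have h4 := T_le hS hL _ _ h3
      have h5 := hS.2.1 i j (lam.rowLen i - 1) hp h3 (by
        rw [mem_skew hm] at hp; omega)
      omega
    let U : ℕ × ℕ → ℕ := fun p => if p ∈ skewCells lam1 mu then T p else 0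
    have hTU : ∀ p ∈ skewCells lam1 mu, U p = T p := fun p hp => if_pos hp
    refine ⟨U, ⟨?_, ?_, ?_⟩, ?_, ?_⟩
    · rintro ⟨a, b⟩
      by_cases hp : (a, b) ∈ skewCells lam1 mu
      · rw [hTU _ hp]
        exact ⟨fun _ => (hS.1 _).1 (hsub a b hp), fun _ => hp⟩
      · simp only [U]; simp [hp]
    · intro a b1 b2 hp hq hb
      rw [hTU _ hp, hTU _ hq]
      exact hS.2.1 a b1 b2 (hsub _ _ hp) (hsub _ _ hq) hb
    · intro a1 a2 b hp hq ha
      rw [hTU _ hp, hTU _ hq]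
      exact hS.2.2 a1 a2 b (hsub _ _ hp) (hsub _ _ hq) ha
    · intro i j v
      have h3 := hL i j v
      rw [prefix_trim hm h1 hrow hTU hend, prefix_trim hm h1 hrow hTU hend] at h3
      by_cases hε : v + 1 < lam.colLen 0 ∧ (v + 1 < i ∨ (v + 1 = i ∧ j ≤ lam.rowLen (v + 1) - 1))
      · rw [if_pos hε] at h3
        show prefixCount lam1 mu U i j (v + 1 + 1) ≤ prefixCount lam1 mu U i j (v + 1)
        split_ifs at h3 <;> omega
      · have h0 : prefixCount lam1 mu U i j (v + 2) = 0 := by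
          unfold prefixCount
          rw [Finset.card_eq_zero, Finset.filter_eq_empty_iff]
          rintro ⟨a, b⟩ hp ⟨hpre, hU⟩
          rw [hTU _ hp] at hU
          have h4 := T_le hS hL a b (hsub _ _ hp)
          have h5 := row_lt (hsub _ _ hp)
          rw [mem_skew hm] at hp
          have h6 := h1 a
          apply hε
          simp only at hpre
          refine ⟨by omega, ?_⟩
          by_cases h7 : v + 1 < i
          · exact Or.inl h7
          · have : a = v + 1 := by omega
            subst this
            right
            omega
        omega
    · intro i
      have := hc i
      beta_reduce at this
      rw [hcontent T U hTU hend] at this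
      omega

theorem exists_trim (lam : YoungDiagram) :
    ∃ lam1 : YoungDiagram, ∀ i, lam1.rowLen i = lam.rowLen i - 1 := by
  apply exists_young (N := lam.colLen 0)
  · intro a b hab
    have := lam.rowLen_anti a b hab
    show lam.rowLen b - 1 ≤ lam.rowLen a - 1
    omega
  · intro i hi
    have := rowLen_pos_iff lam i
    omega

theorem N_le {lam mu alp bet : YoungDiagram} {l k : ℕ}
    (hm : ∀ i j, (i, j) ∈ mu ↔ i < l ∧ j < k)
    (hrow : ∀ i, i < l → k < lam.rowLen i)
    (h : ∀ f, Cont lam mu f ↔ Cont alp bet f) : lam.colLen 0 ≤ alp.colLen 0 := by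
  obtain ⟨lam1, h1⟩ := exists_trim lam
  have h2 := (trim_cont hm h1 hrow _).1 (nuS_cont hm)
  by_contra hlt
  have h3 := cont_zero ((h _).1 h2) (le_refl _)
  rw [if_pos (by omega)] at h3
  omega

theorem trim_inv {lam mu alp bet lam1 alp1 : YoungDiagram} {l k q p : ℕ}
    (hm : ∀ i j, (i, j) ∈ mu ↔ i < l ∧ j < k)
    (hb : ∀ i j, (i, j) ∈ bet ↔ i < q ∧ j < p)
    (hrow : ∀ i, i < l → k < lam.rowLen i)
    (hrow' : ∀ i, i < q → p < alp.rowLen i)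
    (h1 : ∀ i, lam1.rowLen i = lam.rowLen i - 1)
    (h2 : ∀ i, alp1.rowLen i = alp.rowLen i - 1)
    (h : ∀ f, Cont lam mu f ↔ Cont alp bet f) (f : ℕ → ℕ) :
    Cont lam1 mu f ↔ Cont alp1 bet f := by
  have e : lam.colLen 0 = alp.colLen 0 :=
    le_antisymm (N_le hm hrow h) (N_le hb hrow' (fun f => (h f).symm))
  rw [trim_cont hm h1 hrow, trim_cont hb h2 hrow', h, e]

theorem content_change {lam mu : YoungDiagram} {T U : ℕ × ℕ → ℕ} {p0 : ℕ × ℕ}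
    (hp0 : p0 ∈ skewCells lam mu) (h : ∀ p ∈ skewCells lam mu, p ≠ p0 → U p = T p) (w : ℕ) :
    content lam mu U w + (if T p0 = w then 1 else 0) =
      content lam mu T w + (if U p0 = w then 1 else 0) := by
  unfold content
  rw [Finset.card_filter, Finset.card_filter, ← Finset.add_sum_erase _ _ hp0,
    ← Finset.add_sum_erase (skewCells lam mu) (fun p => if T p = w then 1 else 0) hp0]
  have : ∑ x ∈ (skewCells lam mu).erase p0, (if U x = w then 1 else 0) =
      ∑ x ∈ (skewCells lam mu).erase p0, (if T x = w then 1 else 0) := by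
    apply Finset.sum_congr rfl
    intro p hp
    rw [Finset.mem_erase] at hp
    rw [h p hp.2 hp.1]
  rw [this]
  omega

theorem le_iff_of_sum {lam mu : YoungDiagram} {l k : ℕ} {T : ℕ × ℕ → ℕ}
    (hm : ∀ i j, (i, j) ∈ mu ↔ i < l ∧ j < k) (hS : IsSSYT lam mu T) (m : ℕ)
    (h : ∑ i ∈ Finset.range m, content lam mu T (i + 1) = ∑ i ∈ Finset.range m, nuS lam l k i)
    {p : ℕ × ℕ} (hp : p ∈ skewCells lam mu) (hm' : minFill lam mu l k p ≤ m) : T p ≤ m := by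
  have e2 : ∑ i ∈ Finset.range m, nuS lam l k i =
      ∑ i ∈ Finset.range m, content lam mu (minFill lam mu l k) (i + 1) :=
    Finset.sum_congr rfl fun i _ => (minFill_content hm i).symm
  rw [e2, ncells_le (fun p hp => T_pos hS hp),
    ncells_le (fun p hp => T_pos (minFill_ssyt hm) hp)] at h
  have := Finset.eq_of_subset_of_card_le (s := (skewCells lam mu).filter fun p => T p ≤ m)
    (t := (skewCells lam mu).filter fun p => minFill lam mu l k p ≤ m) (by
      rintro ⟨i, j⟩ hp
      simp only [Finset.mem_filter] at hp ⊢
      exact ⟨hp.1, le_trans (T_ge hm hS i j hp.1) hp.2⟩) h.ge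
  have h3 : p ∈ (skewCells lam mu).filter fun p => minFill lam mu l k p ≤ m :=
    Finset.mem_filter.2 ⟨hp, hm'⟩
  rw [← this] at h3
  exact (Finset.mem_filter.1 h3).2

/-- A filling with the same content as the minimal filling is the minimal filling. -/
theorem eq_minFill {lam mu : YoungDiagram} {l k : ℕ} {T : ℕ × ℕ → ℕ}
    (hm : ∀ i j, (i, j) ∈ mu ↔ i < l ∧ j < k) (hS : IsSSYT lam mu T)
    (h : ∀ i, content lam mu T (i + 1) = nuS lam l k i)
    {p : ℕ × ℕ} (hp : p ∈ skewCells lam mu) : T p = minFill lam mu l k p := by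
  apply le_antisymm
  · exact le_iff_of_sum hm hS _ (Finset.sum_congr rfl fun i _ => h i) hp (le_refl _)
  · obtain ⟨i, j⟩ := p
    exact T_ge hm hS i j hp

/-- The one-box modification of the extremal content. -/
def SP (lam mu : YoungDiagram) (l k a : ℕ) : Prop :=
  ∃ f, Cont lam mu f ∧ ∀ i, f i + (if i = a then 1 else 0) =
    nuS lam l k i + (if i = a + 1 then 1 else 0)

theorem SP_of {lam mu : YoungDiagram} {l k a : ℕ}
    (hm : ∀ i j, (i, j) ∈ mu ↔ i < l ∧ j < k) (hl : 0 < l)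
    (h1 : lam.rowLen (a + 1) - k < lam.rowLen a - k)
    (h2 : min (lam.rowLen (l + (a + 1))) k < min (lam.rowLen (l + a)) k) :
    SP lam mu l k a := by
  have e : l + (a + 1) = l + a + 1 := by omega
  rw [e] at h2
  obtain ⟨c, hc⟩ : ∃ c, min (lam.rowLen (l + a)) k = c + 1 :=
    ⟨min (lam.rowLen (l + a)) k - 1, by omega⟩
  have hs := modFill_ssyt (lam := lam) (c := c) (r := a) (s := a + 1) hm (by omega) (by omega)
  have hL := modFill_lattice (lam := lam) (c := c) (r := a) (s := a) hm (by omega) (le_refl _)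
    (by omega) (by omega)
  refine ⟨fun i => content lam mu (modFill lam mu l k c a (a + 1)) (i + 1),
    ⟨_, hs, hL, fun i => rfl⟩, ?_⟩
  intro i
  have hp0 : (l + a, c) ∈ skewCells lam mu := by rw [mem_skew hm]; omega
  have h3 := content_change (T := minFill lam mu l k) (U := modFill lam mu l k c a (a + 1))
    hp0 (by
      rintro ⟨x, y⟩ hp hne
      simp only [modFill, minFill, hp, if_true]
      split_ifs with h4 h5 h5
      · exfalso
        apply hne
        rw [mem_skew hm] at hp
        have : x = l + a := by
          by_contra hx
          have := lam.rowLen_anti (l + a + 1) x (by omega)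
          omega
        rw [this, h5.1]
      · rfl
      · rfl) (i + 1)
  have e1 : minFill lam mu l k (l + a, c) = a + 1 := by
    simp only [minFill, hp0, if_true]; rw [if_pos (by omega)]; omega
  have e2 : modFill lam mu l k c a (a + 1) (l + a, c) = a + 2 := by
    simp only [modFill, hp0, if_true, le_refl, and_self]; rw [if_pos (by omega)]; omega
  rw [e1, e2, minFill_content hm] at h3
  split_ifs at h3 ⊢ <;> omega

theorem of_SP {lam mu : YoungDiagram} {l k a : ℕ}
    (hm : ∀ i j, (i, j) ∈ mu ↔ i < l ∧ j < k) (hl : 0 < l) (h : SP lam mu l k a) :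
    lam.rowLen (a + 1) - k < lam.rowLen a - k ∧
    min (lam.rowLen (l + (a + 1))) k < min (lam.rowLen (l + a)) k := by
  obtain ⟨f, ⟨T, hS, hL, hc⟩, hf⟩ := h
  have hlo : ∀ m, m ≤ a → ∑ i ∈ Finset.range m, content lam mu T (i + 1) =
      ∑ i ∈ Finset.range m, nuS lam l k i := by
    intro m hm'
    apply Finset.sum_congr rfl
    intro i hi
    rw [Finset.mem_range] at hi
    have := hf i
    rw [if_neg (by omega), if_neg (by omega)] at this
    rw [hc]; omega
  have hmid : ∑ i ∈ Finset.range (a + 1), content lam mu T (i + 1) + 1 =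
      ∑ i ∈ Finset.range (a + 1), nuS lam l k i := by
    rw [Finset.sum_range_succ, Finset.sum_range_succ, hlo a le_rfl, hc]
    have := hf a
    rw [if_pos rfl, if_neg (by omega)] at this
    omega
  have hhi : ∀ d, ∑ i ∈ Finset.range (a + 2 + d), content lam mu T (i + 1) =
      ∑ i ∈ Finset.range (a + 2 + d), nuS lam l k i := by
    intro d
    induction d with
    | zero =>
      rw [Nat.add_zero, Finset.sum_range_succ, Finset.sum_range_succ _ (a + 1), ← hmid, hc]
      have := hf (a + 1)
      rw [if_neg (by omega), if_pos rfl] at this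
      omega
    | succ d ih =>
      rw [← Nat.add_assoc, Finset.sum_range_succ, Finset.sum_range_succ _ (a + 2 + d), ih, hc]
      have := hf (a + 2 + d)
      rw [if_neg (by omega), if_neg (by omega)] at this
      omega
  have hne : ∀ m, m ≠ a + 1 → ∑ i ∈ Finset.range m, content lam mu T (i + 1) =
      ∑ i ∈ Finset.range m, nuS lam l k i := by
    intro m hm'
    by_cases h : m ≤ a
    · exact hlo m h
    · obtain ⟨d, rfl⟩ : ∃ d, m = a + 2 + d := ⟨m - a - 2, by omega⟩
      exact hhi d
  -- the cell that was changed
  have hex : ∃ p0 ∈ skewCells lam mu, minFill lam mu l k p0 ≤ a + 1 ∧ a + 1 < T p0 := by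
    by_contra hno
    push Not at hno
    have e2 : ∑ i ∈ Finset.range (a + 1), nuS lam l k i =
        ∑ i ∈ Finset.range (a + 1), content lam mu (minFill lam mu l k) (i + 1) :=
      Finset.sum_congr rfl fun i _ => (minFill_content hm i).symm
    rw [e2, ncells_le (fun p hp => T_pos hS hp),
      ncells_le (fun p hp => T_pos (minFill_ssyt hm) hp)] at hmid
    have := Finset.card_le_card (s := (skewCells lam mu).filter
        fun p => minFill lam mu l k p ≤ a + 1)
      (t := (skewCells lam mu).filter fun p => T p ≤ a + 1) (by
        intro p hp
        simp only [Finset.mem_filter] at hp ⊢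
        exact ⟨hp.1, hno p hp.1 hp.2⟩)
    omega
  obtain ⟨⟨i, c⟩, hp0, h1, h2⟩ := hex
  have h3 : T (i, c) ≤ a + 2 := le_iff_of_sum hm hS (a + 2) (hne _ (by omega)) hp0 (by omega)
  have h4 : minFill lam mu l k (i, c) = a + 1 := by
    by_contra h5
    have := le_iff_of_sum hm hS a (hne _ (by omega)) hp0 (by omega)
    omega
  have hck : c < k := by
    by_contra hck
    have h5 := T_eq_right hm hS hL hp0 (by omega)
    simp only [minFill, hp0, if_true, if_neg hck] at h4
    omega
  have hp0' := hp0
  rw [mem_skew hm] at hp0'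
  have hi : i = l + a := by
    simp only [minFill, hp0, if_true, if_pos hck] at h4
    omega
  subst hi
  have hout : lam.rowLen (l + a + 1) ≤ c := by
    by_contra hin
    have hp1 : (l + a + 1, c) ∈ skewCells lam mu := by rw [mem_skew hm]; omega
    have h5 := hS.2.2 (l + a) (l + a + 1) c hp0 hp1 (by omega)
    have h6 : minFill lam mu l k (l + a + 1, c) = a + 2 := by
      simp only [minFill, hp1, if_true, if_pos hck]; omega
    have := le_iff_of_sum hm hS (a + 2) (hne _ (by omega)) hp1 (by omega)
    omega
  refine ⟨?_, by rw [← Nat.add_assoc]; omega⟩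
  have hlat : prefixCount lam mu T (l + a) c (a + 2) ≤ prefixCount lam mu T (l + a) c (a + 1) :=
    hL (l + a) c a
  have hA : prefixCount lam mu T (l + a) c (a + 1) ≤ lam.rowLen a - k := by
    rw [← Nat.card_Ico]
    unfold prefixCount
    apply Finset.card_le_card_of_injOn Prod.snd
    · rintro ⟨x, y⟩ hx
      simp only [Finset.coe_filter, Set.mem_ofPred_eq] at hx
      obtain ⟨hx1, hx2, hx3⟩ := hx
      have h5 := T_ge hm hS x y hx1
      by_cases hy : y < k
      · exfalso
        have h6 : ¬ (x = l + a ∧ c ≤ y) := by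
          rintro ⟨rfl, h6⟩
          have := hS.2.1 (l + a) c y hp0 hx1 h6
          omega
        have h7 : minFill lam mu l k (x, y) = x - l + 1 := by
          simp only [minFill, hx1, if_true, if_pos hy]
        have h8 := le_iff_of_sum hm hS (x - l + 1) (hne _ (by
          rw [mem_skew hm] at hx1; omega)) hx1 (by omega)
        rw [mem_skew hm] at hx1
        omega
      · have h6 := T_eq_right hm hS hL hx1 (by omega)
        have : x = a := by omega
        subst this
        rw [mem_skew hm] at hx1
        simp only [Finset.coe_Ico, Set.mem_Ico]
        omega
    · rintro ⟨x, y⟩ hx ⟨x', y'⟩ hx' hxy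
      simp only [Finset.coe_filter, Set.mem_ofPred_eq] at hx hx' hxy
      subst hxy
      by_contra hne'
      rcases lt_trichotomy x x' with h5 | h5 | h5
      · have := hS.2.2 x x' y hx.1 hx'.1 h5; omega
      · exact hne' (by rw [h5])
      · have := hS.2.2 x' x y hx'.1 hx.1 h5; omega
  have hB : lam.rowLen (a + 1) - k + 1 ≤ prefixCount lam mu T (l + a) c (a + 2) := by
    have hni : (l + a, c) ∉ (Finset.Ico k (lam.rowLen (a + 1))).image (fun j => (a + 1, j)) := by
      simp only [Finset.mem_image, Finset.mem_Ico, Prod.mk.injEq]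
      rintro ⟨j, hj, -, rfl⟩
      omega
    have e : (insert (l + a, c) ((Finset.Ico k (lam.rowLen (a + 1))).image
        (fun j => (a + 1, j)))).card = lam.rowLen (a + 1) - k + 1 := by
      rw [Finset.card_insert_of_notMem hni, Finset.card_image_of_injective, Nat.card_Ico]
      intro x y hxy; simpa using hxy
    rw [← e]
    unfold prefixCount
    apply Finset.card_le_card
    rintro ⟨x, y⟩ hx
    rw [Finset.mem_insert, Finset.mem_image] at hx
    rw [Finset.mem_filter]
    rcases hx with hx | ⟨j, hj, hx⟩
    · rw [Prod.mk.injEq] at hx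
      obtain ⟨rfl, rfl⟩ := hx
      exact ⟨hp0, Or.inr ⟨rfl, le_refl _⟩, by omega⟩
    · rw [Prod.mk.injEq] at hx
      obtain ⟨rfl, rfl⟩ := hx
      rw [Finset.mem_Ico] at hj
      have hq : (a + 1, j) ∈ skewCells lam mu := by rw [mem_skew hm]; omega
      refine ⟨hq, ?_, T_eq_right hm hS hL hq hj.1⟩
      simp only
      omega
  omega

theorem SP_iff {lam mu : YoungDiagram} {l k : ℕ}
    (hm : ∀ i j, (i, j) ∈ mu ↔ i < l ∧ j < k) (hl : 0 < l) (a : ℕ) : SP lam mu l k a ↔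
    lam.rowLen (a + 1) - k < lam.rowLen a - k ∧
    min (lam.rowLen (l + (a + 1))) k < min (lam.rowLen (l + a)) k :=
  ⟨of_SP hm hl, fun h => SP_of hm hl h.1 h.2⟩

theorem SP_inv {lam mu alp bet : YoungDiagram} {l k q p : ℕ}
    (hm : ∀ i j, (i, j) ∈ mu ↔ i < l ∧ j < k)
    (hb : ∀ i j, (i, j) ∈ bet ↔ i < q ∧ j < p)
    (h : ∀ f, Cont lam mu f ↔ Cont alp bet f) (a : ℕ) :
    SP lam mu l k a ↔ SP alp bet q p a := by
  unfold SP
  simp only [h, nuS_inv hm hb h]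

theorem card_image_anti {f : ℕ → ℕ} (hf : Antitone f) (N : ℕ) :
    ((Finset.range (N + 1)).image f).card =
      (∑ i ∈ Finset.range N, if f (i + 1) < f i then 1 else 0) + 1 := by
  induction N with
  | zero => simp
  | succ N ih =>
    rw [Finset.range_add_one, Finset.image_insert, Finset.sum_range_succ]
    have h : f (N + 1) ≤ f N := hf (Nat.le_succ N)
    by_cases hlt : f (N + 1) < f N
    · rw [Finset.card_insert_of_notMem, ih, if_pos hlt]
      · intro hmem
        obtain ⟨i, hi, he⟩ := Finset.mem_image.1 hmem
        have := hf (Nat.lt_succ_iff.1 (Finset.mem_range.1 hi))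
        omega
    · rw [Finset.insert_eq_of_mem, ih, if_neg hlt]
      exact Finset.mem_image.2 ⟨N, Finset.mem_range.2 (by omega), by omega⟩

theorem rowLen_antitone (lam : YoungDiagram) : Antitone lam.rowLen :=
  fun a b h => lam.rowLen_anti a b h

theorem dp_eq (lam : YoungDiagram) :
    dp lam = ∑ i ∈ Finset.range (lam.colLen 0),
      if lam.rowLen (i + 1) < lam.rowLen i then 1 else 0 := by
  have h := card_image_anti (rowLen_antitone lam) (lam.colLen 0)
  rw [Finset.range_add_one, Finset.image_insert, Finset.card_insert_of_notMem] at h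
  · unfold dp
    have h2 : (Finset.image (fun i => lam.rowLen i) (Finset.range (lam.colLen 0))).card =
      (Finset.image lam.rowLen (Finset.range (lam.colLen 0))).card := rfl
    omega
  · intro hmem
    obtain ⟨i, hi, he⟩ := Finset.mem_image.1 hmem
    have h1 := (rowLen_pos_iff lam i).2 (Finset.mem_range.1 hi)
    have h2 := rowLen_pos_iff lam (lam.colLen 0)
    omega

theorem sum_pad {f : ℕ → ℕ} {N : ℕ} (h : ∀ i, N ≤ i → f i = 0) (l : ℕ) :
    ∑ i ∈ Finset.range (l + N), f i = ∑ i ∈ Finset.range N, f i := by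
  rw [Nat.add_comm, Finset.sum_range_add]
  rw [Finset.sum_eq_zero (s := Finset.range l), Nat.add_zero]
  intro i _
  exact h _ (by omega)

theorem lt_P (lam : YoungDiagram) (k j : ℕ) : j < lam.colLen k ↔ k < lam.rowLen j := by
  rw [← mem_iff_lt_colLen, ← mem_iff_lt_rowLen]

theorem dp_formula {lam mu : YoungDiagram} {l k : ℕ}
    (hm : ∀ i j, (i, j) ∈ mu ↔ i < l ∧ j < k) (hl : 0 < l) (hk : k < lam.rowLen l) :
    dp lam + (if lam.rowLen (lam.colLen k) < k then 1 else 0) =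
      (∑ i ∈ Finset.range (lam.colLen 0), if nuS lam l k (i + 1) < nuS lam l k i then 1 else 0) +
      ∑ i ∈ Finset.range (lam.colLen 0), if SP lam mu l k i then 1 else 0 := by
  set N := lam.colLen 0 with hN
  have hz : ∀ i, N ≤ i → lam.rowLen i = 0 := by
    intro i hi
    have := rowLen_pos_iff lam i
    omega
  have hanti := lam.rowLen_anti
  have e1 : (∑ i ∈ Finset.range N, if nuS lam l k (i + 1) < nuS lam l k i then 1 else 0) +
      (∑ i ∈ Finset.range N, if SP lam mu l k i then 1 else 0) =
      (∑ i ∈ Finset.range N, if lam.rowLen (i + 1) < lam.rowLen i ∧ k < lam.rowLen i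
        then 1 else 0) +
      ∑ i ∈ Finset.range N, if lam.rowLen (l + i + 1) < lam.rowLen (l + i) ∧
        lam.rowLen (l + i + 1) < k then 1 else 0 := by
    rw [← Finset.sum_add_distrib, ← Finset.sum_add_distrib]
    apply Finset.sum_congr rfl
    intro i _
    simp only [SP_iff hm hl, nuS, ← Nat.add_assoc]
    have h1 := hanti i (i + 1) (by omega)
    have h2 := hanti (l + i) (l + i + 1) (by omega)
    split_ifs <;> omega
  have e2 : (∑ i ∈ Finset.range N, if lam.rowLen (l + i + 1) < lam.rowLen (l + i) ∧
        lam.rowLen (l + i + 1) < k then 1 else 0) =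
      ∑ j ∈ Finset.range (l + N), if lam.rowLen (j + 1) < lam.rowLen j ∧
        lam.rowLen (j + 1) < k then 1 else 0 := by
    rw [Finset.sum_range_add]
    rw [Finset.sum_eq_zero (s := Finset.range l), Nat.zero_add]
    intro i hi
    rw [Finset.mem_range] at hi
    have := hanti (i + 1) l (by omega)
    rw [if_neg (by omega)]
  have e3 : (∑ j ∈ Finset.range (l + N), if lam.rowLen (j + 1) < lam.rowLen j ∧
        lam.rowLen (j + 1) < k then 1 else 0) =
      ∑ j ∈ Finset.range N, if lam.rowLen (j + 1) < lam.rowLen j ∧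
        lam.rowLen (j + 1) < k then 1 else 0 := by
    apply sum_pad
    intro i hi
    have := hz i hi
    rw [if_neg (by omega)]
  rw [e1, e2, e3, dp_eq, ← Finset.sum_add_distrib, ← hN]
  set P := lam.colLen k with hP
  have hPl := lt_P lam k
  have hlP : l < P := (hPl l).2 hk
  have hPN : P ≤ N := by
    by_contra h
    have := (hPl N).1 (by omega)
    have := hz N le_rfl
    omega
  have e4 : (if lam.rowLen P < k then 1 else 0) =
      ∑ j ∈ Finset.range N, if j = P - 1 then (if lam.rowLen P < k then 1 else 0) else 0 := by
    rw [Finset.sum_ite_eq' , if_pos (Finset.mem_range.2 (by omega))]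
  rw [e4, ← Finset.sum_add_distrib]
  apply Finset.sum_congr rfl
  intro j _
  have h1 := hanti j (j + 1) (by omega)
  by_cases hj : j = P - 1
  · have hj1 : j + 1 = P := by omega
    have h2 := (hPl j).1 (by omega)
    have h3 := hPl (j + 1)
    rw [if_pos hj, hj1] at *
    split_ifs <;> omega
  · rw [if_neg hj]
    have h2 := hPl j
    have h3 := hPl (j + 1)
    split_ifs <;> omega

theorem bit_char {lam lam1 mu : YoungDiagram} {l k : ℕ}
    (hm : ∀ i j, (i, j) ∈ mu ↔ i < l ∧ j < k) (hl : 0 < l) (hk0 : 0 < k)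
    (hk : k < lam.rowLen l) (h1 : ∀ i, lam1.rowLen i = lam.rowLen i - 1) :
    ((∀ i, nuS lam l k i ≤ nuS lam1 l k i + 1) ∧ lam.rowLen (lam.colLen k) < k) ∨
    ∃ d, nuS lam l k (d + 1) = nuS lam1 l k (d + 1) + 2 ∧
      (∀ i, i < d + 1 → nuS lam l k i = nuS lam1 l k i + 1) ∧
      (lam.rowLen (lam.colLen k) < k ↔ ((SP lam mu l k d ↔ SP lam1 mu l k d) ∧
        (nuS lam l k (d + 1) < nuS lam l k d ↔ nuS lam1 l k (d + 1) < nuS lam1 l k d))) := by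
  set P := lam.colLen k with hP
  have hPl := lt_P lam k
  have hlP : l < P := (hPl l).2 hk
  have hanti := lam.rowLen_anti
  have hPk := hPl P
  by_cases hP0 : lam.rowLen P = 0
  · left
    refine ⟨fun i => ?_, by omega⟩
    simp only [nuS, h1]
    have h2 := hPl (l + i)
    by_cases h3 : l + i < P
    · omega
    · have := hanti P (l + i) (by omega)
      omega
  · right
    obtain ⟨d, hd⟩ : ∃ d, P = l + d + 1 := ⟨P - l - 1, by omega⟩
    have a1 := hPl d
    have a2 := hPl (d + 1)
    have a3 := hPl (l + d)
    have a4 : l + (d + 1) = P := by omega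
    have b1 := hanti d (d + 1) (by omega)
    refine ⟨d, ?_, ?_, ?_⟩
    · simp only [nuS, h1, a4]
      omega
    · intro i hi
      have := hPl i
      have := hPl (l + i)
      simp only [nuS, h1]
      omega
    · rw [SP_iff hm hl, SP_iff hm hl]
      simp only [nuS, h1, a4]
      omega

theorem dp_eq_of_both {lam mu alp bet : YoungDiagram} {l k q p : ℕ}
    (hm : ∀ i j, (i, j) ∈ mu ↔ i < l ∧ j < k)
    (hb : ∀ i j, (i, j) ∈ bet ↔ i < q ∧ j < p)
    (hl : 0 < l) (hk0 : 0 < k) (hk : k < lam.rowLen l)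
    (hq : 0 < q) (hp0 : 0 < p) (hp : p < alp.rowLen q)
    (h : ∀ f, Cont lam mu f ↔ Cont alp bet f) : dp lam = dp alp := by
  have hrow : ∀ i, i < l → k < lam.rowLen i := by
    intro i hi
    have := lam.rowLen_anti i l hi.le
    omega
  have hrow' : ∀ i, i < q → p < alp.rowLen i := by
    intro i hi
    have := alp.rowLen_anti i q hi.le
    omega
  have hN : lam.colLen 0 = alp.colLen 0 :=
    le_antisymm (N_le hm hrow h) (N_le hb hrow' (fun f => (h f).symm))
  obtain ⟨lam1, h1⟩ := exists_trim lam
  obtain ⟨alp1, h2⟩ := exists_trim alp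
  have h' := trim_inv hm hb hrow hrow' h1 h2 h
  have n0 := nuS_inv hm hb h
  have n1 := nuS_inv hm hb h'
  have s0 := SP_inv hm hb h
  have s1 := SP_inv hm hb h'
  have f1 := dp_formula hm hl hk
  have f2 := dp_formula hb hq hp
  simp only [n0, s0, hN] at f1
  have key : lam.rowLen (lam.colLen k) < k ↔ alp.rowLen (alp.colLen p) < p := by
    have c1 := bit_char hm hl hk0 hk h1
    have c2 := bit_char hb hq hp0 hp h2
    simp only [n0, n1, s0, s1] at c1
    rcases c1 with ⟨x1, x2⟩ | ⟨d, x1, x2, x3⟩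
    · rcases c2 with ⟨y1, y2⟩ | ⟨e, y1, y2, y3⟩
      · exact ⟨fun _ => y2, fun _ => x2⟩
      · have := x1 (e + 1)
        omega
    · rcases c2 with ⟨y1, y2⟩ | ⟨e, y1, y2, y3⟩
      · have := y1 (d + 1)
        omega
      · have hde : d = e := by
          rcases lt_trichotomy d e with hlt | heq | hlt
          · have := y2 (d + 1) (by omega); omega
          · exact heq
          · have := x2 (e + 1) (by omega); omega
        subst hde
        rw [x3, y3]
  simp only [key] at f1
  omega

theorem nuS_empty (lam : YoungDiagram) (i : ℕ) : nuS lam 0 0 i = lam.rowLen i := by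
  simp [nuS]

theorem cont_empty {lam mu : YoungDiagram} (hm : ∀ i j, (i, j) ∈ mu ↔ i < 0 ∧ j < 0)
    {f : ℕ → ℕ} (hf : Cont lam mu f) (i : ℕ) : f i = lam.rowLen i := by
  obtain ⟨T, hS, hL, hc⟩ := hf
  rw [← hc, ← nuS_empty, ← minFill_content hm]
  unfold content
  congr 1
  apply Finset.filter_congr
  rintro ⟨a, b⟩ hp
  rw [T_eq_right hm hS hL hp (Nat.zero_le _),
    T_eq_right hm (minFill_ssyt hm) (minFill_lattice hm) hp (Nat.zero_le _)]

theorem dp_one_empty {lam mu alp bet : YoungDiagram} {q p : ℕ}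
    (hm : ∀ i j, (i, j) ∈ mu ↔ i < 0 ∧ j < 0)
    (hb : ∀ i j, (i, j) ∈ bet ↔ i < q ∧ j < p)
    (hq : 0 < q) (hp0 : 0 < p) (hp : p < alp.rowLen q)
    (h : ∀ f, Cont lam mu f ↔ Cont alp bet f) : dp lam ≤ 2 ∧ dp alp ≤ 1 := by
  have hrow' : ∀ i, i < q → p < alp.rowLen i := by
    intro i hi
    have := alp.rowLen_anti i q hi.le
    omega
  have hN : lam.colLen 0 = alp.colLen 0 :=
    le_antisymm (N_le hm (by omega) h) (N_le hb hrow' (fun f => (h f).symm))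
  have n0 : ∀ i, lam.rowLen i = nuS alp q p i := fun i => by
    rw [← nuS_inv hm hb h, nuS_empty]
  set N := alp.colLen 0 with hNdef
  have hposA := rowLen_pos_iff alp
  have hposL := rowLen_pos_iff lam
  have hqN : q < N := (hposA q).1 (by omega)
  have hlast : p < alp.rowLen (N - 1) := by
    have h1 := n0 (N - 1)
    have h2 := hposL (N - 1)
    have h3 := hposA (q + (N - 1))
    simp only [nuS] at h1
    omega
  have hbig : ∀ i, i < N → p < alp.rowLen i := by
    intro i hi
    have := alp.rowLen_anti i (N - 1) (by omega)
    omega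
  have hstep : ∀ s, s + 1 < N → alp.rowLen (s + 1) = alp.rowLen s := by
    intro s hs
    by_contra hne
    have hlt : alp.rowLen (s + 1) < alp.rowLen s := by
      have := alp.rowLen_anti s (s + 1) (by omega)
      omega
    obtain ⟨r, hr1, hr2, hr3⟩ : ∃ r, r ≤ s ∧ s + 1 ≤ q + r ∧ q + r < N := by
      by_cases hc : q + s < N
      · exact ⟨s, by omega, by omega, hc⟩
      · exact ⟨N - q - 1, by omega, by omega, by omega⟩
    have hS := modFill_ssyt (lam := alp) (c := p - 1) (r := r) (s := s + 1) hb
      (Or.inl (by omega)) hr2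
    have hL := modFill_lattice (lam := alp) (c := p - 1) (r := r) (s := s) hb hr2 hr1
      (hbig s (by omega)) hlt
    have hC : Cont alp bet
        (fun i => content alp bet (modFill alp bet q p (p - 1) r (s + 1)) (i + 1)) :=
      ⟨_, hS, hL, fun i => rfl⟩
    have h3 := cont_empty hm ((h _).2 hC)
    have h4 := hbig (q + r) hr3
    have hcell : (q + r, p - 1) ∈ skewCells alp bet := by
      rw [mem_skew hb]; omega
    have h5 := eq_minFill hb hS (fun i => by rw [← n0]; exact h3 i) hcell
    simp only [modFill, minFill, hcell, if_true, le_refl, and_self] at h5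
    rw [if_pos (by omega), if_pos (by omega)] at h5
    omega
  have hconst : ∀ s, s < N → alp.rowLen s = alp.rowLen 0 := by
    intro s
    induction s with
    | zero => intro _; rfl
    | succ s ih =>
      intro hs
      rw [hstep s hs, ih (by omega)]
  constructor
  · have hsub : ((Finset.range (lam.colLen 0)).image fun i => lam.rowLen i) ⊆
        {alp.rowLen 0 - p + min (alp.rowLen 0) p, alp.rowLen 0 - p} := by
      intro x hx
      obtain ⟨i, hi, rfl⟩ := Finset.mem_image.1 hx
      rw [Finset.mem_range, hN] at hi
      rw [Finset.mem_insert, Finset.mem_singleton, n0, nuS, hconst i hi]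
      by_cases hc : q + i < N
      · left; rw [hconst _ hc]
      · right
        have := hposA (q + i)
        omega
    exact le_trans (Finset.card_le_card hsub) Finset.card_le_two
  · have hsub : ((Finset.range (alp.colLen 0)).image fun i => alp.rowLen i) ⊆
        {alp.rowLen 0} := by
      intro x hx
      obtain ⟨i, hi, rfl⟩ := Finset.mem_image.1 hx
      rw [Finset.mem_range] at hi
      rw [Finset.mem_singleton, hconst i hi]
    exact le_trans (Finset.card_le_card hsub) (Finset.card_singleton _).le

theorem rect_setup {lam mu : YoungDiagram} (hmu : mu ≤ lam) (hr : IsRect mu)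
    (hb : IsBasic lam mu) (hc : IsConnectedSkew lam mu) :
    (∀ i j, (i, j) ∈ mu ↔ i < 0 ∧ j < 0) ∨
    ∃ l k, (∀ i j, (i, j) ∈ mu ↔ i < l ∧ j < k) ∧ 0 < l ∧ 0 < k ∧ k < lam.rowLen l := by
  have hpos := rowLen_pos_iff mu
  have hm : ∀ i j, (i, j) ∈ mu ↔ i < mu.colLen 0 ∧ j < mu.rowLen 0 := by
    intro i j
    rw [mem_iff_lt_rowLen]
    by_cases hi : i < mu.colLen 0
    · rw [hr i hi]; simp [hi]
    · have := hpos i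
      omega
  by_cases hl : mu.colLen 0 = 0
  · left
    intro i j
    rw [hm, hl]
    omega
  · right
    refine ⟨mu.colLen 0, mu.rowLen 0, hm, by omega, (hpos 0).2 (by omega), ?_⟩
    have h00 : ((0, 0) : ℕ × ℕ) ∈ lam := hmu ((hm 0 0).2 ⟨by omega, (hpos 0).2 (by omega)⟩)
    have h1 := hb.2 0 (mem_iff_lt_rowLen.1 h00)
    have h2 := hc (mu.colLen 0 - 1) (by omega)
    rw [hr _ (by omega)] at h2
    have e : mu.colLen 0 - 1 + 1 = mu.colLen 0 := by omega
    rwa [e] at h2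

/-- if `lam` has exactly 3 distinct part sizes and `lam/mu`, `alp/bet` are
basic connected skew diagrams with rectangular inner shapes and equal skew Schur functions,
then `alp` also has exactly 3 distinct part sizes. -/
theorem dp_three_forces_dp_three (lam mu alp bet : YoungDiagram)
    (hmu : mu ≤ lam) (hbet : bet ≤ alp)
    (hdp : dp lam = 3) (hrectmu : IsRect mu) (hrectbet : IsRect bet)
    (hbasic1 : IsBasic lam mu) (hconn1 : IsConnectedSkew lam mu)
    (hbasic2 : IsBasic alp bet) (hconn2 : IsConnectedSkew alp bet)
    (h : SchurEq lam mu alp bet) :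
    dp alp = 3 := by
  have hC := cont_iff hmu hbet h
  rcases rect_setup hmu hrectmu hbasic1 hconn1 with hm | ⟨l, k, hm, hl, hk0, hk⟩
  · rcases rect_setup hbet hrectbet hbasic2 hconn2 with hb | ⟨q, p, hb, hq, hp0, hp⟩
    · have n0 : ∀ i, lam.rowLen i = alp.rowLen i := fun i => by
        rw [← nuS_empty, ← nuS_empty, nuS_inv hm hb hC]
      have hN : lam.colLen 0 = alp.colLen 0 :=
        le_antisymm (N_le hm (by omega) hC) (N_le hb (by omega) (fun f => (hC f).symm))
      rw [← hdp, dp, dp]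
      simp only [n0, hN]
    · have := dp_one_empty hm hb hq hp0 hp hC
      omega
  · rcases rect_setup hbet hrectbet hbasic2 hconn2 with hb | ⟨q, p, hb, hq, hp0, hp⟩
    · have := dp_one_empty hb hm hl hk0 hk (fun f => (hC f).symm)
      omega
    · rw [← dp_eq_of_both hm hb hl hk0 hk hq hp0 hp hC, hdp]

end LRSkew
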